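/- arXiv:2202.05011 — 3 statements merged into one kernel-verified Lean document; each statement's English description precedes it below -/
import Mathlib

section
/- Let A be a real m×n matrix and B a real n×p matrix satisfying AB = 0. Then ℝⁿ admits an orthogonal direct sum decomposition ℝⁿ = im(Aᵀ) ⊕ ker(AᵀA + BBᵀ) ⊕ im(B); that is, the three subspaces im(Aᵀ), ker(AᵀA + BBᵀ), and im(B) of ℝⁿ are pairwise orthogonal and their sum is all of ℝⁿ. -/
open Matrix Submodule

section Adjoint

variable {E F G : Type*}
  [NormedAddCommGroup E] [InnerProductSpace ℝ E] [FiniteDimensional ℝ E]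
  [NormedAddCommGroup F] [InnerProductSpace ℝ F] [FiniteDimensional ℝ F]
  [NormedAddCommGroup G] [InnerProductSpace ℝ G]

theorem LinearMap.ker_adjoint_comp_add_comp_adjoint [FiniteDimensional ℝ G]
    (S : E →ₗ[ℝ] F) (T : G →ₗ[ℝ] E) :
    LinearMap.ker (S.adjoint ∘ₗ S + T ∘ₗ T.adjoint) =
      LinearMap.ker S ⊓ LinearMap.ker T.adjoint := by
  ext x
  simp only [Submodule.mem_inf, LinearMap.mem_ker, LinearMap.add_apply, LinearMap.comp_apply]
  refine ⟨fun h => ?_, fun ⟨hS, hT⟩ => by simp [hS, hT]⟩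
  have h_sum : inner ℝ (S x) (S x) + inner ℝ (T.adjoint x) (T.adjoint x) = 0 := by
    rw [← LinearMap.adjoint_inner_left, LinearMap.adjoint_inner_right, ← inner_add_left, h,
      inner_zero_left]
  have hS : 0 ≤ inner ℝ (S x) (S x) := real_inner_self_nonneg
  have hT : 0 ≤ inner ℝ (T.adjoint x) (T.adjoint x) := real_inner_self_nonneg
  exact ⟨inner_self_eq_zero (𝕜 := ℝ).mp (by linarith), inner_self_eq_zero (𝕜 := ℝ).mp (by linarith)⟩

theorem LinearMap.ker_adjoint_comp_add_comp_adjoint_eq_orthogonal [FiniteDimensional ℝ G]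
    (S : E →ₗ[ℝ] F) (T : G →ₗ[ℝ] E) :
    LinearMap.ker (S.adjoint ∘ₗ S + T ∘ₗ T.adjoint) =
      (LinearMap.range S.adjoint ⊔ LinearMap.range T)ᗮ := by
  rw [LinearMap.ker_adjoint_comp_add_comp_adjoint, ← Submodule.inf_orthogonal,
    LinearMap.orthogonal_range, LinearMap.orthogonal_range, LinearMap.adjoint_adjoint]

theorem LinearMap.isOrtho_range_adjoint_range {S : E →ₗ[ℝ] F} {T : G →ₗ[ℝ] E}
    (h : S ∘ₗ T = 0) : LinearMap.range S.adjoint ⟂ LinearMap.range T := by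
  rw [Submodule.isOrtho_comm, Submodule.isOrtho_iff_le, LinearMap.orthogonal_range,
    LinearMap.adjoint_adjoint]
  exact LinearMap.range_le_ker_iff.mpr h

end Adjoint

/-- **Hodge decomposition.** If `A : ℝ^{m×n}` and `B : ℝ^{n×p}` satisfy `AB = 0`, then
`ℝⁿ = im(Aᵀ) ⊕ ker(AᵀA + BBᵀ) ⊕ im(B)` is an orthogonal direct sum decomposition:
the three subspaces are pairwise orthogonal and their sum is all of `ℝⁿ`. -/
theorem hodge_decomposition (m n p : ℕ)
    (A : Matrix (Fin m) (Fin n) ℝ) (B : Matrix (Fin n) (Fin p) ℝ)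
    (hAB : A * B = 0) :
    (Submodule.IsOrtho (LinearMap.range (Matrix.toEuclideanLin Aᵀ))
        (LinearMap.ker (Matrix.toEuclideanLin (Aᵀ * A + B * Bᵀ))) ∧
      Submodule.IsOrtho (LinearMap.range (Matrix.toEuclideanLin Aᵀ))
        (LinearMap.range (Matrix.toEuclideanLin B)) ∧
      Submodule.IsOrtho (LinearMap.ker (Matrix.toEuclideanLin (Aᵀ * A + B * Bᵀ)))
        (LinearMap.range (Matrix.toEuclideanLin B))) ∧
    LinearMap.range (Matrix.toEuclideanLin Aᵀ)
        ⊔ LinearMap.ker (Matrix.toEuclideanLin (Aᵀ * A + B * Bᵀ))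
        ⊔ LinearMap.range (Matrix.toEuclideanLin B)
      = (⊤ : Submodule ℝ (EuclideanSpace ℝ (Fin n))) := by
  have hA : toEuclideanLin Aᵀ = (toEuclideanLin A).adjoint := by
    rw [← toEuclideanLin_conjTranspose_eq_adjoint, conjTranspose_eq_transpose_of_trivial]
  have hB : toEuclideanLin Bᵀ = (toEuclideanLin B).adjoint := by
    rw [← toEuclideanLin_conjTranspose_eq_adjoint, conjTranspose_eq_transpose_of_trivial]
  have h_comp : toEuclideanLin A ∘ₗ toEuclideanLin B = 0 := by
    rw [← toLpLin_mul, hAB, map_zero]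
  have h_ker : LinearMap.ker (toEuclideanLin (Aᵀ * A + B * Bᵀ)) =
      (LinearMap.range (toEuclideanLin Aᵀ) ⊔ LinearMap.range (toEuclideanLin B))ᗮ := by
    rw [map_add, toLpLin_mul (q := 2), toLpLin_mul (q := 2), hA, hB,
      LinearMap.ker_adjoint_comp_add_comp_adjoint_eq_orthogonal]
  rw [h_ker]
  refine ⟨⟨(isOrtho_orthogonal_right _).mono_left le_sup_left,
    hA ▸ LinearMap.isOrtho_range_adjoint_range h_comp,
    (isOrtho_orthogonal_left _).mono_right le_sup_right⟩, ?_⟩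
  rw [sup_right_comm, sup_orthogonal_of_hasOrthogonalProjection]
end

section
/- Let A be a real m×n matrix and B a real n×p matrix satisfying AB = 0 (so that im(B) ⊆ ker(A)). Then ker(AᵀA + BBᵀ) is isomorphic as a real vector space to the quotient space ker(A)/im(B); in particular, dim ker(AᵀA + BBᵀ) = dim ker(A) − rank(B). -/
open Matrix

/-- The kernel of `AᵀA + BBᵀ` is the intersection of the kernels of `A` and `Bᵀ`. -/
theorem Matrix.mem_ker_transpose_mul_self_add_mul_transpose {m n p : Type*}
    [Fintype m] [Fintype n] [Fintype p] (A : Matrix m n ℝ) (B : Matrix n p ℝ) (x : n → ℝ) :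
    x ∈ LinearMap.ker (Aᵀ * A + B * Bᵀ).mulVecLin ↔ A *ᵥ x = 0 ∧ Bᵀ *ᵥ x = 0 := by
  rw [LinearMap.mem_ker, mulVecLin_apply, add_mulVec, ← mulVec_mulVec, ← mulVec_mulVec]
  refine ⟨fun h => ?_, fun ⟨hA, hB⟩ => by simp [hA, hB]⟩
  have h_sum : (A *ᵥ x) ⬝ᵥ (A *ᵥ x) + (Bᵀ *ᵥ x) ⬝ᵥ (Bᵀ *ᵥ x) = 0 := by
    have h_dot := congrArg (x ⬝ᵥ ·) h
    simpa only [dotProduct_add, dotProduct_zero, dotProduct_mulVec, vecMul_transpose,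
      ← mulVec_transpose B] using h_dot
  have hA : 0 ≤ (A *ᵥ x) ⬝ᵥ (A *ᵥ x) := Finset.sum_nonneg fun i _ => mul_self_nonneg _
  have hB : 0 ≤ (Bᵀ *ᵥ x) ⬝ᵥ (Bᵀ *ᵥ x) := Finset.sum_nonneg fun i _ => mul_self_nonneg _
  exact ⟨dotProduct_self_eq_zero.mp (by linarith), dotProduct_self_eq_zero.mp (by linarith)⟩

/-- The kernel of `Bᵀ` is a complement of the column space of `B`. -/
theorem Matrix.isCompl_ker_transpose_range {n p : Type*} [Fintype n] [Fintype p]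
    (B : Matrix n p ℝ) :
    IsCompl (LinearMap.ker Bᵀ.mulVecLin) (LinearMap.range B.mulVecLin) := by
  refine (Submodule.isCompl_iff_disjoint _ _ ?_).mpr ?_
  · have h_rank : Module.finrank ℝ (LinearMap.range Bᵀ.mulVecLin) =
        Module.finrank ℝ (LinearMap.range B.mulVecLin) := B.rank_transpose
    rw [← LinearMap.finrank_range_add_finrank_ker Bᵀ.mulVecLin, h_rank, add_comm]
  · rw [Submodule.disjoint_def]
    rintro _ hx ⟨w, rfl⟩
    have hw : w ∈ LinearMap.ker (Bᵀ * B).mulVecLin := by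
      simpa [mulVec_mulVec] using hx
    rwa [ker_mulVecLin_transpose_mul_self] at hw

/-- If `AB = 0` (so `im(B) ⊆ ker(A)`), then `ker(AᵀA + BBᵀ)` is isomorphic to the quotient
space `ker(A)/im(B)`, and `dim ker(AᵀA + BBᵀ) = dim ker(A) − rank(B)`. -/
theorem ker_laplacian_iso_homology (m n p : ℕ)
    (A : Matrix (Fin m) (Fin n) ℝ) (B : Matrix (Fin n) (Fin p) ℝ)
    (hAB : A * B = 0) :
    Nonempty
      (LinearMap.ker (Aᵀ * A + B * Bᵀ).mulVecLin ≃ₗ[ℝ]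
        (LinearMap.ker A.mulVecLin ⧸
          Submodule.comap (LinearMap.ker A.mulVecLin).subtype
            (LinearMap.range B.mulVecLin))) ∧
    Module.finrank ℝ (LinearMap.ker (Aᵀ * A + B * Bᵀ).mulVecLin)
      = Module.finrank ℝ (LinearMap.ker A.mulVecLin) - B.rank := by
  have h_mem := mem_ker_transpose_mul_self_add_mul_transpose A B
  have h_compl := B.isCompl_ker_transpose_range
  have h_le : LinearMap.ker (Aᵀ * A + B * Bᵀ).mulVecLin ≤ LinearMap.ker A.mulVecLin :=
    fun x hx => ((h_mem x).mp hx).1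
  have h_range : LinearMap.range B.mulVecLin ≤ LinearMap.ker A.mulVecLin := by
    rintro _ ⟨w, rfl⟩
    simp [mulVec_mulVec, hAB]
  let f := (Submodule.comap (LinearMap.ker A.mulVecLin).subtype
    (LinearMap.range B.mulVecLin)).mkQ ∘ₗ Submodule.inclusion h_le
  have h_inj : Function.Injective f := by
    refine (injective_iff_map_eq_zero f).mpr fun x hx => Subtype.ext ?_
    have hxB : (x : Fin n → ℝ) ∈ LinearMap.range B.mulVecLin := by
      simpa [f, Submodule.Quotient.mk_eq_zero, Submodule.mem_comap] using hx
    exact Submodule.disjoint_def.mp h_compl.disjoint x ((h_mem x).mp x.2).2 hxB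
  have h_surj : Function.Surjective f := by
    intro y
    obtain ⟨⟨x, hx⟩, rfl⟩ := Submodule.mkQ_surjective _ y
    obtain ⟨k, hk, b, hb, rfl⟩ := Submodule.mem_sup.mp
      (h_compl.sup_eq_top ▸ Submodule.mem_top : x ∈ _ ⊔ _)
    have hkA : k ∈ LinearMap.ker A.mulVecLin :=
      (Submodule.add_mem_iff_left _ (h_range hb)).mp hx
    refine ⟨⟨k, (h_mem k).mpr ⟨hkA, hk⟩⟩, (Submodule.Quotient.eq _).mpr ?_⟩
    simpa [Submodule.mem_comap] using hb
  let e := LinearEquiv.ofBijective f ⟨h_inj, h_surj⟩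
  refine ⟨⟨e⟩, ?_⟩
  rw [e.finrank_eq, Submodule.finrank_quotient,
    (Submodule.comapSubtypeEquivOfLe h_range).finrank_eq, Matrix.rank]
end

section
/- Let P and Q be real symmetric positive semidefinite n×n matrices satisfying PQ = 0, and let Π_P denote the orthogonal projection of ℝⁿ onto im(P). Then Π_P (P + Q)† = P†, where † denotes the Moore–Penrose pseudo-inverse. -/
open Matrix

/-- `G` is the Moore–Penrose pseudo-inverse of `M`. -/
def IsMoorePenrose {a b : ℕ} (M : Matrix (Fin a) (Fin b) ℝ)
    (G : Matrix (Fin b) (Fin a) ℝ) : Prop :=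
  M * G * M = M ∧ G * M * G = G ∧ (M * G)ᵀ = M * G ∧ (G * M)ᵀ = G * M

/-- A matrix whose column space lies in that of `B` is a right multiple of `B`. -/
theorem exists_eq_mul_of_range_mulVecLin_le {R l m n : Type*} [CommSemiring R]
    [Fintype m] [Fintype n] [DecidableEq n] {A : Matrix l n R} {B : Matrix l m R}
    (h : LinearMap.range A.mulVecLin ≤ LinearMap.range B.mulVecLin) :
    ∃ X : Matrix m n R, A = B * X := by
  have hcol (j : n) : ∃ w : m → R, B *ᵥ w = A.col j := by
    obtain ⟨w, hw⟩ := h ⟨Pi.single j 1, rfl⟩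
    exact ⟨w, by simpa using hw⟩
  choose w hw using hcol
  refine ⟨(Matrix.of w)ᵀ, ?_⟩
  ext i j
  exact (congrFun (hw j) i).symm

/-- If `P, Q` are symmetric positive semidefinite with `PQ = 0` and `Π` is the orthogonal
projection onto `im(P)` (a symmetric idempotent matrix with range equal to `im(P)`), then
`Π (P + Q)† = P†`: with `P'` and `L'` the Moore–Penrose pseudo-inverses of `P` and `P + Q`,
we have `Π * L' = P'`. -/
theorem proj_mul_pinv_add (n : ℕ)
    (P Q P' L' Pi : Matrix (Fin n) (Fin n) ℝ)
    (hP : P.PosSemidef) (hQ : Q.PosSemidef) (hPQ : P * Q = 0)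
    (hP' : IsMoorePenrose P P') (hL' : IsMoorePenrose (P + Q) L')
    (hPiSym : Piᵀ = Pi) (hPiIdem : Pi * Pi = Pi)
    (hPiRange : LinearMap.range Pi.mulVecLin = LinearMap.range P.mulVecLin) :
    Pi * L' = P' := by
  obtain ⟨X, hX⟩ := exists_eq_mul_of_range_mulVecLin_le hPiRange.le
  obtain ⟨Y, hY⟩ := exists_eq_mul_of_range_mulVecLin_le hPiRange.ge
  have hPt : Pᵀ = P := by simpa [Matrix.IsHermitian] using hP.isHermitian
  have hQt : Qᵀ = Q := by simpa [Matrix.IsHermitian] using hQ.isHermitian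
  have hQP : Q * P = 0 := by simpa [hPt, hQt] using congrArg transpose hPQ
  have hPiX : Pi = Xᵀ * P := by
    rw [← hPiSym, hX, transpose_mul, hPt]
  have hPiP : Pi * P = P := by
    rw [hY, ← mul_assoc, hPiIdem]
  have hPPi : P * Pi = P := by
    simpa [hPt, hPiSym] using congrArg transpose hPiP
  have hPiM : Pi * (P + Q) = P := by
    rw [mul_add, hPiP, hPiX, mul_assoc, hPQ, mul_zero, add_zero]
  have hMPi : (P + Q) * Pi = P := by
    rw [add_mul, hPPi, hX, ← mul_assoc Q, hQP, zero_mul, add_zero]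
  obtain ⟨hP1, hP2, hP3, hP4⟩ := hP'
  obtain ⟨hL1, -, hL3, -⟩ := hL'
  have hEP : (P + Q) * L' * P = P := by
    have h := congrArg (· * Pi) hL1
    simpa only [mul_assoc _ _ Pi, hMPi] using h
  have hPE : P * ((P + Q) * L') = P := by
    have h := congrArg transpose hEP
    rwa [transpose_mul, hL3, hPt] at h
  have hPL : P * L' = Pi := by
    conv_lhs => rw [← hPiM, mul_assoc, hPiX, mul_assoc, hPE]
    exact hPiX.symm
  have hPP' : P * P' = Pi := by
    have h : P * P' * Pi = Pi := by
      rw [hX, ← mul_assoc, hP1]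
    have ht := congrArg transpose h
    rwa [transpose_mul, hP3, hPiSym, ← mul_assoc, hPiP] at ht
  have hP'P : P' * P = Pi := by
    have h : Pi * (P' * P) = Pi := by
      rw [hPiX, mul_assoc, ← mul_assoc P, hP1]
    have ht := congrArg transpose h
    rwa [transpose_mul, hP4, hPiSym, mul_assoc, hPPi] at ht
  calc
    Pi * L' = P' * (P * L') := by rw [← mul_assoc, hP'P]
    _ = P' * P * P' := by rw [hPL, ← hPP', mul_assoc]
    _ = P' := hP2
end
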